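/- Assume condition (G) for some γ ∈ ℕ, d > 0 and L > 0. Let 0 ≤ K < L with [K]+1 ≤ γ and 1 ≤ q ≤ ∞. Let f be a measurable function on ℝ^N × (0,∞) such that E_{K,q}[f] ∈ L^∞(0,T) for every T > 0. Then for any multi-index α with |α| ≤ K there exists a constant C₁ such that |M_α(f(·,t),t)| ≤ C₁ (1+t)^{−(K−|α|)/d} E_{K,q}[f](t) for almost all t > 0. -/

import Mathlib

open MeasureTheory Filter Asymptotics Topology
open scoped ENNReal BigOperators

noncomputable section

/-- Partial derivative in the `i`-th coordinate direction. -/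
def pderivE (N : ℕ) (i : Fin N) (f : EuclideanSpace ℝ (Fin N) → ℝ) :
    EuclideanSpace ℝ (Fin N) → ℝ :=
  fun x => fderiv ℝ f x (EuclideanSpace.single i 1)

/-- Multi-index partial derivative `∂_x^α`. -/
def mderivE (N : ℕ) (α : Fin N → ℕ) (f : EuclideanSpace ℝ (Fin N) → ℝ) :
    EuclideanSpace ℝ (Fin N) → ℝ :=
  (List.ofFn fun i : Fin N => (pderivE N i)^[α i]).foldr (fun T h => T h) f

/-- `x ^ α` for a multi-index `α`. -/
def mpowE (N : ℕ) (α : Fin N → ℕ) (x : EuclideanSpace ℝ (Fin N)) : ℝ :=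
  ∏ i, x i ^ α i

/-- `α !` for a multi-index `α`. -/
def mfactE (N : ℕ) (α : Fin N → ℕ) : ℕ := ∏ i, Nat.factorial (α i)

/-- `g_α(x,t) := ((-1)^{|α|}/α!) ∂_x^α G(x, t+1)`. -/
def gA (N : ℕ) (G : EuclideanSpace ℝ (Fin N) → ℝ → ℝ) (α : Fin N → ℕ)
    (x : EuclideanSpace ℝ (Fin N)) (t : ℝ) : ℝ :=
  ((-1 : ℝ) ^ (∑ i, α i) / (mfactE N α : ℝ)) * mderivE N α (fun y => G y (t + 1)) x

/-- Condition (G) for the kernel `G` with parameters `γ`, `d`, `L`. -/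
structure CondG (N : ℕ) (G : EuclideanSpace ℝ (Fin N) → ℝ → ℝ) (γ : ℕ) (d L : ℝ) : Prop where
  smooth : ContDiffOn ℝ γ (fun p : EuclideanSpace ℝ (Fin N) × ℝ => G p.1 p.2) {p | 0 < p.2}
  scaling : ∀ x : EuclideanSpace ℝ (Fin N), ∀ t : ℝ, 0 < t →
      G x t = t ^ (-(N : ℝ) / d) * G ((t ^ (-(1 : ℝ) / d)) • x) 1
  decay : ∀ j : ℕ, j ≤ γ → ∃ C : ℝ, ∀ x : EuclideanSpace ℝ (Fin N),
      (1 + ‖x‖) ^ ((N : ℝ) + L + j) * ‖iteratedFDeriv ℝ j (fun y => G y 1) x‖ ≤ C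
  semigroup : ∀ x : EuclideanSpace ℝ (Fin N), ∀ t s : ℝ, 0 < s → s < t →
      G x t = ∫ y, G (x - y) (t - s) * G y s

/-- `(e^{tℒ}φ)(x) = ∫ G(x-y,t) φ(y) dy`. -/
def sgOp (N : ℕ) (G : EuclideanSpace ℝ (Fin N) → ℝ → ℝ) (t : ℝ)
    (φ : EuclideanSpace ℝ (Fin N) → ℝ) : EuclideanSpace ℝ (Fin N) → ℝ :=
  fun x => ∫ y, G (x - y) t * φ y

/-- `∫ x^α f(x) dx`. -/
def momE (N : ℕ) (α : Fin N → ℕ) (f : EuclideanSpace ℝ (Fin N) → ℝ) : ℝ :=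
  ∫ x, mpowE N α x * f x

/-- Auxiliary fuelled recursion computing the coefficients `M_α(f,t)`. -/
def McoefAux (N : ℕ) (G : EuclideanSpace ℝ (Fin N) → ℝ → ℝ)
    (f : EuclideanSpace ℝ (Fin N) → ℝ) (t : ℝ) : ℕ → (Fin N → ℕ) → ℝ
  | 0, α => momE N α f
  | n + 1, α => momE N α f -
      ∑ β ∈ (Finset.Iic α).erase α,
        McoefAux N G f t n β * ∫ x, mpowE N α x * gA N G β x t

/-- `M_α(f,t)`, defined inductively on `|α|`:
`M_α(f,t) = ∫ x^α f dx - ∑_{β ≤ α, β ≠ α} M_β(f,t) ∫ x^α g_β(x,t) dx`. -/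
def Mcoef (N : ℕ) (G : EuclideanSpace ℝ (Fin N) → ℝ → ℝ)
    (f : EuclideanSpace ℝ (Fin N) → ℝ) (t : ℝ) (α : Fin N → ℕ) : ℝ :=
  McoefAux N G f t (∑ i, α i) α

/-- The finite set of multi-indices `α` with `|α| ≤ m`. -/
def multiIdx (N m : ℕ) : Finset (Fin N → ℕ) :=
  (Finset.Iic fun _ => m).filter fun α => ∑ i, α i ≤ m

/-- `P_K(t)f := f - ∑_{|α| ≤ K} M_α(f,t) g_α(·,t)`. -/
def PKop (N : ℕ) (G : EuclideanSpace ℝ (Fin N) → ℝ → ℝ) (K : ℝ) (t : ℝ)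
    (f : EuclideanSpace ℝ (Fin N) → ℝ) : EuclideanSpace ℝ (Fin N) → ℝ :=
  fun x => f x - ∑ α ∈ multiIdx N ⌊K⌋₊, Mcoef N G f t α * gA N G α x t

/-- The weighted `L¹` norm `|||φ|||_k = ∫ (1+|x|^k) ‖φ(x)‖ dx`, valued in `ℝ≥0∞`. -/
def wnorm (N : ℕ) {E' : Type*} [NormedAddCommGroup E'] (k : ℝ)
    (φ : EuclideanSpace ℝ (Fin N) → E') : ℝ≥0∞ :=
  ∫⁻ x, ENNReal.ofReal ((1 + ‖x‖ ^ k) * ‖φ x‖)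

/-- Membership in `L¹_k = L¹(ℝ^N, (1+|x|^k)dx)`. -/
def MemL1k (N : ℕ) (k : ℝ) (φ : EuclideanSpace ℝ (Fin N) → ℝ) : Prop :=
  AEStronglyMeasurable φ (volume : Measure (EuclideanSpace ℝ (Fin N))) ∧ wnorm N k φ < ⊤

/-- `E_{K,q}[f](t) = (1+t)^{K/d}[t^{(N/d)(1-1/q)} ‖f(t)‖_q + ‖f(t)‖_1] + |||f(t)|||_K`. -/
def Efun (N : ℕ) (d K : ℝ) (q : ℝ≥0∞) (f : EuclideanSpace ℝ (Fin N) → ℝ → ℝ) (t : ℝ) :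
    ℝ≥0∞ :=
  ENNReal.ofReal ((1 + t) ^ (K / d)) *
      (ENNReal.ofReal (t ^ (((N : ℝ) / d) * (1 - q.toReal⁻¹))) *
          eLpNorm (fun x => f x t) q volume +
        eLpNorm (fun x => f x t) 1 volume) +
    wnorm N K (fun x => f x t)

/-- `t^{(N/d)(1-1/q)} ‖w(t)‖_q + t^{-ℓ/d} |||w(t)|||_ℓ`. -/
def DistQ (N : ℕ) (d : ℝ) (q : ℝ≥0∞) (ℓ : ℝ) (w : EuclideanSpace ℝ (Fin N) → ℝ → ℝ)
    (t : ℝ) : ℝ≥0∞ :=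
  ENNReal.ofReal (t ^ (((N : ℝ) / d) * (1 - q.toReal⁻¹))) * eLpNorm (fun x => w x t) q volume +
    ENNReal.ofReal (t ^ (-ℓ / d)) * wnorm N ℓ (fun x => w x t)

end
theorem pderivE_const_mul_comp_smul (N : ℕ) (i : Fin N) (r : ℝ) (c : ℝ)
    (h : EuclideanSpace ℝ (Fin N) → ℝ) :
    pderivE N i (fun x => c * h (r • x)) = fun x => c * r * pderivE N i h (r • x) := by
  funext x
  have h1 : fderiv ℝ (fun x => c * h (r • x)) x = c • fderiv ℝ (fun x => h (r • x)) x :=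
    congrFun (fderiv_const_smul_field (𝕜 := ℝ) (f := fun x => h (r • x)) c) x
  simp only [pderivE, h1, fderiv_comp_smul, _root_.smul_apply, smul_eq_mul]
  ring

theorem pderivE_iterate_const_mul_comp_smul (N : ℕ) (i : Fin N) (r : ℝ) (k : ℕ) (c : ℝ)
    (h : EuclideanSpace ℝ (Fin N) → ℝ) :
    (pderivE N i)^[k] (fun x => c * h (r • x)) =
      fun x => c * r ^ k * (pderivE N i)^[k] h (r • x) := by
  induction k with
  | zero => simp
  | succ k ih =>
    rw [Function.iterate_succ_apply', ih, pderivE_const_mul_comp_smul,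
      Function.iterate_succ_apply', pow_succ, mul_assoc]

/-- A composition of operators, each homogeneous of degree `k i` under dilations, is homogeneous
of degree `∑ i, k i`. -/
theorem foldr_ofFn_const_mul_comp_smul {E : Type*} [SMul ℝ E] (r : ℝ) {n : ℕ}
    (T : Fin n → (E → ℝ) → E → ℝ) (k : Fin n → ℕ)
    (hT : ∀ i c h, T i (fun x => c * h (r • x)) = fun x => c * r ^ k i * T i h (r • x))
    (c : ℝ) (h : E → ℝ) :
    (List.ofFn T).foldr (fun T h => T h) (fun x => c * h (r • x)) =
      fun x => c * r ^ (∑ i, k i) * (List.ofFn T).foldr (fun T h => T h) h (r • x) := by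
  induction n generalizing c h with
  | zero => simp
  | succ n ih =>
    rw [List.ofFn_succ, List.foldr_cons, List.foldr_cons,
      ih (fun i => T i.succ) (fun i => k i.succ) (fun i => hT i.succ), hT, Fin.sum_univ_succ]
    funext x
    ring

theorem mderivE_const_mul_comp_smul (N : ℕ) (α : Fin N → ℕ) (r : ℝ) (c : ℝ)
    (h : EuclideanSpace ℝ (Fin N) → ℝ) :
    mderivE N α (fun x => c * h (r • x)) =
      fun x => c * r ^ (∑ i, α i) * mderivE N α h (r • x) :=
  foldr_ofFn_const_mul_comp_smul r (fun i => (pderivE N i)^[α i]) α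
    (fun i c h => pderivE_iterate_const_mul_comp_smul N i r (α i) c h) c h

theorem mpowE_smul (N : ℕ) (α : Fin N → ℕ) (r : ℝ) (x : EuclideanSpace ℝ (Fin N)) :
    mpowE N α (r • x) = r ^ (∑ i, α i) * mpowE N α x := by
  simp [mpowE, mul_pow, Finset.prod_mul_distrib, Finset.prod_pow_eq_pow_sum]

theorem abs_mpowE_le (N : ℕ) (α : Fin N → ℕ) (x : EuclideanSpace ℝ (Fin N)) :
    |mpowE N α x| ≤ ‖x‖ ^ (∑ i, α i) := by
  rw [mpowE, Finset.abs_prod, ← Finset.prod_pow_eq_pow_sum]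
  refine Finset.prod_le_prod (fun i _ => abs_nonneg _) fun i _ => ?_
  rw [abs_pow]
  exact pow_le_pow_left₀ (abs_nonneg _) (PiLp.norm_apply_le x i) _

/-- The moments of `g_β(·,t)` scale like `(1+t)^{(|α|-|β|)/d}`. -/
theorem integral_mpowE_mul_gA {N : ℕ} {G : EuclideanSpace ℝ (Fin N) → ℝ → ℝ} {d : ℝ}
    (hG : ∀ x : EuclideanSpace ℝ (Fin N), ∀ t : ℝ, 0 < t →
      G x t = t ^ (-(N : ℝ) / d) * G ((t ^ (-(1 : ℝ) / d)) • x) 1)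
    (α β : Fin N → ℕ) {t : ℝ} (ht : 0 < t) :
    ∫ x, mpowE N α x * gA N G β x t =
      (1 + t) ^ (((∑ i, α i : ℕ) - (∑ i, β i : ℕ) : ℝ) / d) *
        ∫ x, mpowE N α x * gA N G β x 0 := by
  have hs : 0 < 1 + t := by positivity
  set r : ℝ := (1 + t) ^ (-(1 : ℝ) / d) with hr
  have hr0 : 0 < r := Real.rpow_pos_of_pos hs _
  set a := ∑ i, α i with ha
  set b := ∑ i, β i with hb
  have hpow (n : ℕ) : r ^ n = (1 + t) ^ (-(n : ℝ) / d) := by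
    rw [hr, ← Real.rpow_mul_natCast hs.le]
    congr 1
    ring
  have key (x : EuclideanSpace ℝ (Fin N)) : mpowE N α x * gA N G β x t =
      ((r ^ a)⁻¹ * r ^ N * r ^ b) * (mpowE N α (r • x) * gA N G β (r • x) 0) := by
    have h1 : (fun y => G y (t + 1)) = fun y => r ^ N * (fun z => G z 1) (r • y) := by
      funext y
      rw [hG y (t + 1) (by positivity), add_comm t 1, hpow N]
    rw [gA, gA, h1, mderivE_const_mul_comp_smul N β r (r ^ N) fun z => G z 1, mpowE_smul,
      ← ha, ← hb, zero_add]
    field_simp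
  simp_rw [key]
  rw [integral_const_mul,
    Measure.integral_comp_smul volume (fun x => mpowE N α x * gA N G β x 0) r,
    finrank_euclideanSpace_fin, abs_of_pos (by positivity), smul_eq_mul, ← mul_assoc]
  congr 1
  have h2 : (1 + t) ^ (((a : ℝ) - (b : ℝ)) / d) = (r ^ a)⁻¹ * r ^ b := by
    rw [hpow, hpow, ← Real.rpow_neg hs.le, ← Real.rpow_add hs]
    congr 1
    ring
  rw [h2]
  field_simp

/-- Interpolation between the weights `1` and `ρ ^ K` at scale `R`. -/
theorem pow_le_rpow_mul_add {K R ρ : ℝ} {a : ℕ} (ha : (a : ℝ) ≤ K) (hR : 0 < R) (hρ : 0 ≤ ρ) :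
    ρ ^ a ≤ R ^ ((a : ℝ) - K) * (R ^ K + (1 + ρ ^ K)) := by
  rcases le_total ρ R with h | h
  · calc ρ ^ a ≤ R ^ a := pow_le_pow_left₀ hρ h a
      _ = R ^ ((a : ℝ) - K) * R ^ K := by
        rw [← Real.rpow_add hR, sub_add_cancel, Real.rpow_natCast]
      _ ≤ _ := by
        gcongr
        have := Real.rpow_nonneg hρ K
        linarith
  · have hρ0 : 0 < ρ := hR.trans_le h
    calc ρ ^ a = ρ ^ ((a : ℝ) - K) * ρ ^ K := by
          rw [← Real.rpow_add hρ0, sub_add_cancel, Real.rpow_natCast]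
      _ ≤ R ^ ((a : ℝ) - K) * ρ ^ K := by
          gcongr ?_ * _
          exact Real.rpow_le_rpow_of_nonpos hR h (by linarith)
      _ ≤ _ := by
          gcongr
          have := Real.rpow_nonneg hR.le K
          linarith

/-- The moment of order `α` is controlled by `(1+t)^{-(K-|α|)/d} E_{K,q}`. -/
theorem ofReal_abs_momE_le {N : ℕ} {d K : ℝ} (q : ℝ≥0∞)
    {f : EuclideanSpace ℝ (Fin N) → ℝ → ℝ} {t : ℝ} (ht : 0 < t)
    (hf : Measurable fun x => f x t) {α : Fin N → ℕ} (hα : ((∑ i, α i : ℕ) : ℝ) ≤ K) :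
    ENNReal.ofReal |momE N α (fun x => f x t)| ≤
      ENNReal.ofReal ((1 + t) ^ (-(K - (∑ i, α i : ℕ)) / d)) * Efun N d K q f t := by
  have hs : 0 < 1 + t := by positivity
  set a := ∑ i, α i with ha
  set R : ℝ := (1 + t) ^ (1 / d) with hR
  have hR0 : 0 < R := Real.rpow_pos_of_pos hs _
  have hpow (y : ℝ) : (1 + t) ^ (y / d) = R ^ y := by
    rw [hR, ← Real.rpow_mul hs.le]
    congr 1
    ring
  have hpt (x : EuclideanSpace ℝ (Fin N)) : ‖mpowE N α x * f x t‖ₑ ≤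
      ENNReal.ofReal (R ^ ((a : ℝ) - K)) *
        (ENNReal.ofReal (R ^ K) * ‖f x t‖ₑ + ENNReal.ofReal ((1 + ‖x‖ ^ K) * ‖f x t‖)) := by
    rw [← ofReal_norm, ← ofReal_norm, ← ENNReal.ofReal_mul (by positivity),
      ← ENNReal.ofReal_add (by positivity) (by positivity), ← ENNReal.ofReal_mul (by positivity)]
    apply ENNReal.ofReal_le_ofReal
    rw [norm_mul, ← add_mul, ← mul_assoc]
    gcongr
    exact (abs_mpowE_le N α x).trans (pow_le_rpow_mul_add hα hR0 (norm_nonneg x))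
  rw [hpow, neg_sub, Efun, hpow, momE, ← Real.norm_eq_abs, ofReal_norm]
  calc _ ≤ ∫⁻ x, ‖mpowE N α x * f x t‖ₑ := enorm_integral_le_lintegral_enorm _
    _ ≤ ∫⁻ x, ENNReal.ofReal (R ^ ((a : ℝ) - K)) *
        (ENNReal.ofReal (R ^ K) * ‖f x t‖ₑ + ENNReal.ofReal ((1 + ‖x‖ ^ K) * ‖f x t‖)) :=
      lintegral_mono hpt
    _ = ENNReal.ofReal (R ^ ((a : ℝ) - K)) *
        (ENNReal.ofReal (R ^ K) * eLpNorm (fun x => f x t) 1 volume +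
          wnorm N K (fun x => f x t)) := by
      rw [lintegral_const_mul' _ _ ENNReal.ofReal_ne_top,
        lintegral_add_left (hf.enorm.const_mul _),
        lintegral_const_mul' _ _ ENNReal.ofReal_ne_top, eLpNorm_one_eq_lintegral_enorm, wnorm]
    _ ≤ _ := by
      gcongr
      exact le_add_self

theorem exists_McoefAux_bound {N : ℕ} {G : EuclideanSpace ℝ (Fin N) → ℝ → ℝ} {d : ℝ}
    (hG : ∀ x : EuclideanSpace ℝ (Fin N), ∀ t : ℝ, 0 < t →
      G x t = t ^ (-(N : ℝ) / d) * G ((t ^ (-(1 : ℝ) / d)) • x) 1)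
    {K : ℝ} (q : ℝ≥0∞) {f : EuclideanSpace ℝ (Fin N) → ℝ → ℝ}
    (hf : ∀ t, Measurable fun x => f x t) (n : ℕ) (α : Fin N → ℕ)
    (hα : ((∑ i, α i : ℕ) : ℝ) ≤ K) :
    ∃ C : ℝ, 0 < C ∧ ∀ t : ℝ, 0 < t →
      ENNReal.ofReal |McoefAux N G (fun x => f x t) t n α| ≤
        ENNReal.ofReal (C * (1 + t) ^ (-(K - (∑ i, α i : ℕ)) / d)) * Efun N d K q f t := by
  induction n generalizing α with
  | zero =>
    refine ⟨1, one_pos, fun t ht => ?_⟩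
    rw [one_mul]
    exact ofReal_abs_momE_le q ht (hf t) hα
  | succ n ih =>
    have hβ (β : Fin N → ℕ) (hβ : β ∈ (Finset.Iic α).erase α) :
        ((∑ i, β i : ℕ) : ℝ) ≤ K := by
      refine le_trans ?_ hα
      exact_mod_cast Finset.sum_le_sum fun i _ => Finset.mem_Iic.1 (Finset.mem_of_mem_erase hβ) i
    choose! C hC0 hC using ih
    refine ⟨1 + ∑ β ∈ (Finset.Iic α).erase α, C β * |∫ x, mpowE N α x * gA N G β x 0|, ?_, ?_⟩
    · have := Finset.sum_nonneg fun β h =>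
        mul_nonneg (hC0 β (hβ β h)).le (abs_nonneg (∫ x, mpowE N α x * gA N G β x 0))
      linarith
    intro t ht
    have hs : 0 < 1 + t := by positivity
    by_cases hE : Efun N d K q f t = ⊤
    · rw [hE, ENNReal.mul_top]
      · exact le_top
      · have := Finset.sum_nonneg fun β h =>
          mul_nonneg (hC0 β (hβ β h)).le (abs_nonneg (∫ x, mpowE N α x * gA N G β x 0))
        rw [Ne, ENNReal.ofReal_eq_zero, not_le]
        have := Real.rpow_pos_of_pos hs (-(K - (∑ i, α i : ℕ)) / d)
        positivity
    have hM := ofReal_abs_momE_le (d := d) q ht (hf t) hα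
    have hC' (β) (h : β ∈ (Finset.Iic α).erase α) := hC β (hβ β h) t ht
    rw [← ENNReal.ofReal_toReal hE] at hM hC' ⊢
    set e := (Efun N d K q f t).toReal
    have he : 0 ≤ e := ENNReal.toReal_nonneg
    rw [← ENNReal.ofReal_mul' he, ENNReal.ofReal_le_ofReal_iff (by positivity)] at hM
    rw [← ENNReal.ofReal_mul' he]
    apply ENNReal.ofReal_le_ofReal
    rw [McoefAux, add_mul, add_mul, one_mul, Finset.sum_mul, Finset.sum_mul]
    refine (abs_sub _ _).trans (add_le_add hM ((Finset.abs_sum_le_sum_abs _ _).trans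
      (Finset.sum_le_sum fun β h => ?_)))
    have hb := hC' β h
    have hCβ := hC0 β (hβ β h)
    rw [← ENNReal.ofReal_mul' he, ENNReal.ofReal_le_ofReal_iff (by positivity)] at hb
    rw [integral_mpowE_mul_gA hG α β ht, abs_mul, abs_mul,
      abs_of_pos (Real.rpow_pos_of_pos hs _)]
    calc _ ≤ C β * (1 + t) ^ (-(K - (∑ i, β i : ℕ)) / d) * e *
          ((1 + t) ^ (((∑ i, α i : ℕ) - (∑ i, β i : ℕ) : ℝ) / d) *
            |∫ x, mpowE N α x * gA N G β x 0|) := by gcongr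
      _ = C β * |∫ x, mpowE N α x * gA N G β x 0| *
          ((1 + t) ^ (-(K - (∑ i, β i : ℕ)) / d) *
            (1 + t) ^ (((∑ i, α i : ℕ) - (∑ i, β i : ℕ) : ℝ) / d)) * e := by ring
      _ = _ := by
        rw [← Real.rpow_add hs]
        congr 3
        ring

/-- Theorem 1.2 (i): if `E_{K,q}[f] ∈ L^∞(0,T)` for every `T > 0`, then for each
multi-index `α` with `|α| ≤ K` there is `C₁` with
`|M_α(f(t),t)| ≤ C₁ (1+t)^{-(K-|α|)/d} E_{K,q}[f](t)` for a.e. `t > 0`. -/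
theorem stmt2 (N γ : ℕ) (hN : 1 ≤ N) (d L : ℝ) (hd : 0 < d) (hL : 0 < L)
    (G : EuclideanSpace ℝ (Fin N) → ℝ → ℝ) (hG : CondG N G γ d L)
    (K : ℝ) (hK0 : 0 ≤ K) (hKL : K < L) (hKγ : ⌈K⌉₊ + 1 ≤ γ)
    (q : ℝ≥0∞) (hq : 1 ≤ q)
    (f : EuclideanSpace ℝ (Fin N) → ℝ → ℝ)
    (hf : Measurable fun p : EuclideanSpace ℝ (Fin N) × ℝ => f p.1 p.2)
    (hE : ∀ T : ℝ, 0 < T → ∃ C : ℝ,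
      ∀ᵐ t ∂(volume.restrict (Set.Ioo (0 : ℝ) T)), Efun N d K q f t ≤ ENNReal.ofReal C)
    (α : Fin N → ℕ) (hα : (∑ i, α i) ≤ ⌊K⌋₊) :
    ∃ C₁ : ℝ, 0 < C₁ ∧
      ∀ᵐ t ∂(volume.restrict (Set.Ioi (0 : ℝ))),
        ENNReal.ofReal |Mcoef N G (fun x => f x t) t α| ≤
          ENNReal.ofReal (C₁ * (1 + t) ^ (-(K - (∑ i, α i : ℕ)) / d)) * Efun N d K q f t := by
  obtain ⟨C, hC0, hC⟩ := exists_McoefAux_bound hG.scaling (K := K) q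
    (fun t => hf.comp measurable_prodMk_right) (∑ i, α i) α
    ((Nat.cast_le.2 hα).trans (Nat.floor_le hK0))
  refine ⟨C, hC0, ?_⟩
  filter_upwards [ae_restrict_mem measurableSet_Ioi] with t ht
  exact hC t ht
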